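/- arXiv:1309.1461 — 2 statements merged into one kernel-verified Lean document; each statement's English description precedes it below -/
import Mathlib

section
/- Fix constants C# > 0 and Θ > 0. For each j ∈ ℕ (j ≥ 1), let γ_j : [0, L_j] → ℝ² be an injective unit-speed curve of class C⁴ with 0 < L_j ≤ 4π whose curvature κ_j satisfies κ_j(s) > 0, |κ_j'(s)| ≤ C#·(κ_j(s) + 2Θ)², and |κ_j''(s)| ≤ C#·(κ_j(s) + 2Θ)³ for all s ∈ [0, L_j]. Assume that for all s, t ∈ [0, L_j] one has ((1 + 1/j)·κ_j(s)/2)·‖γ_j(s) − γ_j(t)‖² − ⟨γ_j(s) − γ_j(t), ν_j(s)⟩ ≥ 0 (the inscribed radius is at least 1/((1+1/j)·κ_j) at every point), and that κ_j(p_j) = 1 for some p_j ∈ [0, L_j]. Then sup_{s ∈ [0, L_j]} κ_j(s) → 1 as j → ∞. -/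
open Real Set Filter

noncomputable section

/-- The second derivative of a plane curve, componentwise. -/
def d2 (γ : ℝ → ℝ × ℝ) (s : ℝ) : ℝ × ℝ :=
  (deriv (fun u => (deriv γ u).1) s, deriv (fun u => (deriv γ u).2) s)

/-- The outward unit normal `ν(s) = (γ'₂(s), −γ'₁(s))` of a unit-speed plane curve. -/
def nor (γ : ℝ → ℝ × ℝ) (s : ℝ) : ℝ × ℝ := ((deriv γ s).2, -(deriv γ s).1)

/-- The geodesic curvature `κ(s) = γ'₁(s)·γ''₂(s) − γ'₂(s)·γ''₁(s)` of a unit-speed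
plane curve. -/
def curv (γ : ℝ → ℝ × ℝ) (s : ℝ) : ℝ :=
  (deriv γ s).1 * (d2 γ s).2 - (deriv γ s).2 * (d2 γ s).1

/-- Euclidean inner product on `ℝ²`. -/
def dot (v w : ℝ × ℝ) : ℝ := v.1 * w.1 + v.2 * w.2

/-- Squared Euclidean norm on `ℝ²`. -/
def nsq (v : ℝ × ℝ) : ℝ := v.1 ^ 2 + v.2 ^ 2

/-- A function whose derivative is nonnegative on `[a, b]` satisfies `f a ≤ f b`. -/
theorem le_of_hasDerivAt_nonneg {f f' : ℝ → ℝ} {a b : ℝ} (hab : a ≤ b)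
    (hf : ∀ s ∈ Icc a b, HasDerivAt f (f' s) s) (hf' : ∀ s ∈ Icc a b, 0 ≤ f' s) :
    f a ≤ f b := by
  have hm : MonotoneOn f (Icc a b) := by
    apply monotoneOn_of_deriv_nonneg (convex_Icc a b)
    · exact fun s hs => (hf s hs).continuousAt.continuousWithinAt
    · exact fun s hs => (hf s (interior_subset hs)).differentiableAt.differentiableWithinAt
    · intro s hs
      rw [(hf s (interior_subset hs)).deriv]
      exact hf' s (interior_subset hs)
  exact hm (left_mem_Icc.2 hab) (right_mem_Icc.2 hab) hab

/-- Comparison of two functions with ordered derivatives on `[a, b]`. -/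
theorem sub_le_sub_of_hasDerivAt_le {f f' g g' : ℝ → ℝ} {a b : ℝ} (hab : a ≤ b)
    (hf : ∀ s ∈ Icc a b, HasDerivAt f (f' s) s) (hg : ∀ s ∈ Icc a b, HasDerivAt g (g' s) s)
    (h : ∀ s ∈ Icc a b, f' s ≤ g' s) : f b - f a ≤ g b - g a := by
  have := le_of_hasDerivAt_nonneg (f := fun s => g s - f s) (f' := fun s => g' s - f' s) hab
    (fun s hs => (hg s hs).sub (hf s hs)) (fun s hs => sub_nonneg.2 (h s hs))
  linarith

/-- A plane curve `(x, y)` with unit tangent `(p, q)` and curvature `k`, whose curvature has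
derivatives `k₁` and `k₂`, satisfying the Frenet equations on `[a, b]`. -/
structure FramedCurve (a b : ℝ) (x y p q k k₁ k₂ : ℝ → ℝ) : Prop where
  x_deriv : ∀ s ∈ Icc a b, HasDerivAt x (p s) s
  y_deriv : ∀ s ∈ Icc a b, HasDerivAt y (q s) s
  p_deriv : ∀ s ∈ Icc a b, HasDerivAt p (-(k s * q s)) s
  q_deriv : ∀ s ∈ Icc a b, HasDerivAt q (k s * p s) s
  unit : ∀ s ∈ Icc a b, p s ^ 2 + q s ^ 2 = 1
  k_deriv : ∀ s ∈ Icc a b, HasDerivAt k (k₁ s) s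
  k₁_deriv : ∀ s ∈ Icc a b, HasDerivAt k₁ (k₂ s) s

namespace FramedCurve

variable {a b : ℝ} {x y p q k k₁ k₂ : ℝ → ℝ}

theorem mono (F : FramedCurve a b x y p q k k₁ k₂) {a' b' : ℝ} (h : Icc a' b' ⊆ Icc a b) :
    FramedCurve a' b' x y p q k k₁ k₂ where
  x_deriv s hs := F.x_deriv s (h hs)
  y_deriv s hs := F.y_deriv s (h hs)
  p_deriv s hs := F.p_deriv s (h hs)
  q_deriv s hs := F.q_deriv s (h hs)
  unit s hs := F.unit s (h hs)
  k_deriv s hs := F.k_deriv s (h hs)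
  k₁_deriv s hs := F.k₁_deriv s (h hs)

/-- Reflecting the curve in the second coordinate axis and reversing its direction. -/
theorem reflect (F : FramedCurve a b x y p q k k₁ k₂) :
    FramedCurve (-b) (-a) (fun s => -x (-s)) (fun s => y (-s)) (fun s => p (-s))
      (fun s => -q (-s)) (fun s => k (-s)) (fun s => -k₁ (-s)) (fun s => k₂ (-s)) := by
  have hmem : ∀ s ∈ Icc (-b) (-a), -s ∈ Icc a b := fun s hs =>
    ⟨by linarith [hs.2], by linarith [hs.1]⟩
  have comp : ∀ {f : ℝ → ℝ} {d s : ℝ}, HasDerivAt f d (-s) →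
      HasDerivAt (fun u => f (-u)) (-d) s := by
    intro f d s hf
    exact (hf.comp s (hasDerivAt_neg s)).congr_deriv (by ring)
  constructor
  · intro s hs
    simpa using (comp (F.x_deriv _ (hmem s hs))).fun_neg
  · intro s hs
    exact comp (F.y_deriv _ (hmem s hs))
  · intro s hs
    simpa using comp (F.p_deriv _ (hmem s hs))
  · intro s hs
    simpa using (comp (F.q_deriv _ (hmem s hs))).fun_neg
  · intro s hs
    simpa using F.unit _ (hmem s hs)
  · intro s hs
    exact comp (F.k_deriv _ (hmem s hs))
  · intro s hs
    simpa using (comp (F.k₁_deriv _ (hmem s hs))).fun_neg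

/-- Along an arc of curvature at most `2`, the tangent turns by at most `2 (t - a)`. -/
theorem turning_bounds (F : FramedCurve a b x y p q k k₁ k₂)
    (hk : ∀ s ∈ Icc a b, 0 < k s ∧ k s ≤ 2) {t : ℝ} (ht : t ∈ Icc a b) :
    |q t * p a - p t * q a| ≤ 2 * (t - a) ∧ |p t * p a + q t * q a| ≤ 1 ∧
      1 - 2 * (t - a) ^ 2 ≤ p t * p a + q t * q a := by
  have hua := F.unit a (left_mem_Icc.2 (ht.1.trans ht.2))
  have hc : ∀ s ∈ Icc a b, |p s * p a + q s * q a| ≤ 1 := by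
    intro s hs
    rw [abs_le_one_iff_mul_self_le_one]
    have h1 : (p s * p a + q s * q a) ^ 2 + (q s * p a - p s * q a) ^ 2 = 1 := by
      have : (p s * p a + q s * q a) ^ 2 + (q s * p a - p s * q a) ^ 2
        = (p s ^ 2 + q s ^ 2) * (p a ^ 2 + q a ^ 2) := by ring
      rw [this, hua, F.unit s hs, one_mul]
    nlinarith [sq_nonneg (q s * p a - p s * q a)]
  have hb' : ∀ s ∈ Icc a b, HasDerivAt (fun u => q u * p a - p u * q a)
      (k s * (p s * p a + q s * q a)) s := by
    intro s hs
    exact (((F.q_deriv s hs).mul_const (p a)).fun_sub ((F.p_deriv s hs).mul_const (q a))).congr_deriv (by ring)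
  have hc' : ∀ s ∈ Icc a b, HasDerivAt (fun u => p u * p a + q u * q a)
      (-(k s * (q s * p a - p s * q a))) s := by
    intro s hs
    exact (((F.p_deriv s hs).mul_const (p a)).fun_add ((F.q_deriv s hs).mul_const (q a))).congr_deriv (by ring)
  have hlin : ∀ c s : ℝ, HasDerivAt (fun u => c * (u - a)) c s := by
    intro c s
    simpa using ((hasDerivAt_id s).sub_const a).const_mul c
  have hb : ∀ s ∈ Icc a b, |q s * p a - p s * q a| ≤ 2 * (s - a) := by
    intro s hs
    have hsub : Icc a s ⊆ Icc a b := Icc_subset_Icc_right hs.2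
    have hbd : ∀ u ∈ Icc a s, |k u * (p u * p a + q u * q a)| ≤ 2 := by
      intro u hu
      rw [abs_mul, abs_of_pos (hk u (hsub hu)).1]
      nlinarith [(hk u (hsub hu)).1, (hk u (hsub hu)).2, hc u (hsub hu),
        abs_nonneg (p u * p a + q u * q a)]
    have h1 := sub_le_sub_of_hasDerivAt_le hs.1 (fun u hu => hb' u (hsub hu))
      (fun u _ => hlin 2 u) (fun u hu => (abs_le.1 (hbd u hu)).2)
    have h2 := sub_le_sub_of_hasDerivAt_le hs.1 (fun u _ => hlin (-2) u)
      (fun u hu => hb' u (hsub hu)) (fun u hu => (abs_le.1 (hbd u hu)).1)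
    rw [abs_le]
    constructor <;> linarith
  refine ⟨hb t ht, hc t ht, ?_⟩
  have hsub : Icc a t ⊆ Icc a b := Icc_subset_Icc_right ht.2
  have hquad : ∀ s : ℝ, HasDerivAt (fun u => -(2 * (u - a) ^ 2)) (-(4 * (s - a))) s := by
    intro s
    refine (((((hasDerivAt_id s).sub_const a).fun_pow 2).const_mul 2).fun_neg).congr_deriv ?_
    simp
    ring
  have h := sub_le_sub_of_hasDerivAt_le ht.1 (fun u _ => hquad u)
    (fun u hu => hc' u (hsub hu)) (by
      intro u hu
      have h1 := (abs_le.1 (hb u (hsub hu))).2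
      nlinarith [(hk u (hsub hu)).1, (hk u (hsub hu)).2, hu.1])
  nlinarith

/-- Length of the chord of an arc of curvature at most `2`. -/
theorem chord_bounds (F : FramedCurve a b x y p q k k₁ k₂) (hab : a ≤ b)
    (hk : ∀ s ∈ Icc a b, 0 < k s ∧ k s ≤ 2) :
    (x a - x b) ^ 2 + (y a - y b) ^ 2 ≤ (b - a) ^ 2 + (b - a) ^ 4 := by
  have hua := F.unit a (left_mem_Icc.2 hab)
  have hf : ∀ s ∈ Icc a b, HasDerivAt (fun u => (y u - y a) * p a - (x u - x a) * q a)
      (q s * p a - p s * q a) s := fun s hs =>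
    (((F.y_deriv s hs).sub_const (y a)).mul_const (p a)).fun_sub
      (((F.x_deriv s hs).sub_const (x a)).mul_const (q a))
  have hg : ∀ s ∈ Icc a b, HasDerivAt (fun u => (x u - x a) * p a + (y u - y a) * q a)
      (p s * p a + q s * q a) s := fun s hs =>
    (((F.x_deriv s hs).sub_const (x a)).mul_const (p a)).fun_add
      (((F.y_deriv s hs).sub_const (y a)).mul_const (q a))
  have hlin : ∀ c s : ℝ, HasDerivAt (fun u => c * (u - a)) c s := by
    intro c s
    simpa using ((hasDerivAt_id s).sub_const a).const_mul c
  have hquad : ∀ c s : ℝ, HasDerivAt (fun u => c * (u - a) ^ 2) (c * (2 * (s - a))) s := by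
    intro c s
    exact ((((hasDerivAt_id s).sub_const a).fun_pow 2).const_mul c).congr_deriv (by simp)
  have hf1 := sub_le_sub_of_hasDerivAt_le hab hf (fun u _ => hquad 1 u) (fun u hu => by
    linarith [(abs_le.1 (F.turning_bounds hk hu).1).2])
  have hf2 := sub_le_sub_of_hasDerivAt_le hab (fun u _ => hquad (-1) u) hf (fun u hu => by
    linarith [(abs_le.1 (F.turning_bounds hk hu).1).1])
  have hg1 := sub_le_sub_of_hasDerivAt_le hab hg (fun u _ => hlin 1 u) (fun u hu =>
    (abs_le.1 (F.turning_bounds hk hu).2.1).2)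
  have hg2 := sub_le_sub_of_hasDerivAt_le hab (fun u _ => hlin (-1) u) hg (fun u hu =>
    (abs_le.1 (F.turning_bounds hk hu).2.1).1)
  simp only [sub_self, zero_mul, sub_zero, add_zero] at hf1 hf2 hg1 hg2
  have hrot : (x a - x b) ^ 2 + (y a - y b) ^ 2
      = ((x b - x a) * p a + (y b - y a) * q a) ^ 2
        + ((y b - y a) * p a - (x b - x a) * q a) ^ 2 := by
    have : ((x b - x a) * p a + (y b - y a) * q a) ^ 2
        + ((y b - y a) * p a - (x b - x a) * q a) ^ 2
        = ((x a - x b) ^ 2 + (y a - y b) ^ 2) * (p a ^ 2 + q a ^ 2) := by ring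
    rw [this, hua, mul_one]
  have hG := sq_le_sq' (a := (x b - x a) * p a + (y b - y a) * q a) (b := b - a)
    (by linarith) (by linarith)
  have hF := sq_le_sq' (a := (y b - y a) * p a - (x b - x a) * q a) (b := (b - a) ^ 2)
    (by linarith) (by linarith)
  rw [hrot]
  nlinarith

/-- Fourth order lower bound for the height of the arc over its tangent line at `a`. -/
theorem height_lower_bound (F : FramedCurve a b x y p q k k₁ k₂) (hab : a ≤ b)
    (hk : ∀ s ∈ Icc a b, 0 < k s ∧ k s ≤ 2) {K : ℝ} (hk₂ : ∀ s ∈ Icc a b, -K ≤ k₂ s) :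
    k a / 2 * (b - a) ^ 2 + k₁ a / 6 * (b - a) ^ 3 - (K + 8) / 24 * (b - a) ^ 4
      ≤ (y b - y a) * p a - (x b - x a) * q a := by
  have hpow : ∀ (c : ℝ) (n : ℕ) (s : ℝ),
      HasDerivAt (fun u => c * (u - a) ^ (n + 1)) (c * ((n + 1) * (s - a) ^ n)) s := by
    intro c n s
    exact ((((hasDerivAt_id s).sub_const a).fun_pow (n + 1)).const_mul c).congr_deriv (by simp)
  have hlow₁ : ∀ s ∈ Icc a b, k₁ a - K * (s - a) ≤ k₁ s := by
    intro s hs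
    have hsub : Icc a s ⊆ Icc a b := Icc_subset_Icc_right hs.2
    have h := sub_le_sub_of_hasDerivAt_le hs.1 (fun u _ => hpow (-K) 0 u)
      (fun u hu => F.k₁_deriv u (hsub hu)) (fun u hu => by simpa using hk₂ u (hsub hu))
    simp at h
    linarith
  have hlow : ∀ s ∈ Icc a b, k a + k₁ a * (s - a) - K / 2 * (s - a) ^ 2 ≤ k s := by
    intro s hs
    have hsub : Icc a s ⊆ Icc a b := Icc_subset_Icc_right hs.2
    have h := sub_le_sub_of_hasDerivAt_le hs.1
      (fun u _ => (hpow (k₁ a) 0 u).fun_sub (hpow (K / 2) 1 u))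
      (fun u hu => F.k_deriv u (hsub hu))
      (fun u hu => by
        have := hlow₁ u (hsub hu)
        norm_num
        linarith)
    simp at h
    linarith
  have hua := F.unit a (left_mem_Icc.2 hab)
  have hb' : ∀ s ∈ Icc a b, HasDerivAt (fun u => q u * p a - p u * q a)
      (k s * (p s * p a + q s * q a)) s := by
    intro s hs
    exact (((F.q_deriv s hs).mul_const (p a)).fun_sub ((F.p_deriv s hs).mul_const (q a))).congr_deriv (by ring)
  have hb : ∀ s ∈ Icc a b, k a * (s - a) + k₁ a / 2 * (s - a) ^ 2 - (K + 8) / 6 * (s - a) ^ 3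
      ≤ q s * p a - p s * q a := by
    intro s hs
    have hsub : Icc a s ⊆ Icc a b := Icc_subset_Icc_right hs.2
    have h := sub_le_sub_of_hasDerivAt_le hs.1
      (fun u _ => ((hpow (k a) 0 u).fun_add (hpow (k₁ a / 2) 1 u)).fun_sub
        (hpow ((K + 8) / 6) 2 u))
      (fun u hu => hb' u (hsub hu))
      (fun u hu => by
        have h1 := hlow u (hsub hu)
        have h2 := (F.turning_bounds hk (hsub hu)).2.2
        have h3 := hk u (hsub hu)
        norm_num
        nlinarith [mul_le_mul_of_nonneg_left h2 h3.1.le,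
          mul_nonneg (sub_nonneg.2 h3.2) (sq_nonneg (u - a))])
    simp at h
    linarith
  have hf : ∀ s ∈ Icc a b, HasDerivAt (fun u => (y u - y a) * p a - (x u - x a) * q a)
      (q s * p a - p s * q a) s := fun s hs =>
    (((F.y_deriv s hs).sub_const (y a)).mul_const (p a)).fun_sub
      (((F.x_deriv s hs).sub_const (x a)).mul_const (q a))
  have h := sub_le_sub_of_hasDerivAt_le hab
    (fun u _ => ((hpow (k a / 2) 1 u).fun_add (hpow (k₁ a / 6) 2 u)).fun_sub
      (hpow ((K + 8) / 24) 3 u)) hf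
    (fun u hu => by
      have := hb u hu
      norm_num
      linarith)
  simp at h
  linarith

/-- If the inscribed radius at `a` is almost the radius of curvature, then the derivative of the
curvature at `a` is almost nonpositive. -/
theorem curvature_deriv_le {δ : ℝ} (hδ : 0 < δ) (hδ1 : δ ≤ 1)
    (F : FramedCurve a (a + δ) x y p q k k₁ k₂)
    (hk : ∀ s ∈ Icc a (a + δ), 0 < k s ∧ k s ≤ 2) {K : ℝ}
    (hk₂ : ∀ s ∈ Icc a (a + δ), -K ≤ k₂ s)
    (hin : (x a - x (a + δ)) * q a - (y a - y (a + δ)) * p a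
      ≤ (1 + δ ^ 2) * k a / 2 * ((x a - x (a + δ)) ^ 2 + (y a - y (a + δ)) ^ 2)) :
    k₁ a ≤ (20 + K / 4) * δ := by
  have hab : a ≤ a + δ := by linarith
  have h1 := F.chord_bounds hab hk
  have h2 := F.height_lower_bound hab hk hk₂
  obtain ⟨hk0, hk2⟩ := hk a (left_mem_Icc.2 hab)
  simp only [add_sub_cancel_left] at h1 h2
  have hδ2 : δ ^ 2 ≤ 1 := by nlinarith
  have h3 : (1 + δ ^ 2) * k a / 2 * ((x a - x (a + δ)) ^ 2 + (y a - y (a + δ)) ^ 2)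
      ≤ (1 + δ ^ 2) * k a / 2 * (δ ^ 2 + δ ^ 4) :=
    mul_le_mul_of_nonneg_left h1 (by positivity)
  have h4 : (1 + δ ^ 2) * k a / 2 * (δ ^ 2 + δ ^ 4) ≤ k a / 2 * δ ^ 2 + 3 * δ ^ 4 := by
    have : (1 + δ ^ 2) * k a / 2 * (δ ^ 2 + δ ^ 4)
        = k a / 2 * δ ^ 2 + k a * ((2 + δ ^ 2) / 2 * δ ^ 4) := by ring
    rw [this]
    have h5 : (2 + δ ^ 2) / 2 * δ ^ 4 ≤ 3 / 2 * δ ^ 4 :=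
      mul_le_mul_of_nonneg_right (by linarith) (by positivity)
    have h6 : 0 ≤ (2 + δ ^ 2) / 2 * δ ^ 4 := by positivity
    nlinarith
  have h7 : k₁ a * δ ^ 3 ≤ (20 + K / 4) * δ * δ ^ 3 := by nlinarith
  exact le_of_mul_le_mul_right h7 (by positivity)

/-- If the inscribed radius is everywhere almost the radius of curvature, then the curvature hardly
increases in the forward direction. -/
theorem curvature_le_forward (F : FramedCurve a b x y p q k k₁ k₂) {c K₁ K δ : ℝ}
    (hlen : b - a ≤ 13) (hδ : 0 < δ) (hδ1 : δ ≤ 1) (hc : c ∈ Icc a b) (hkc : k c = 1)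
    (hk : ∀ s ∈ Icc a b, 0 < k s) (hK₁ : 0 ≤ K₁) (hK : 0 ≤ K)
    (hk₁ : ∀ s ∈ Icc a b, k s ≤ 2 → k₁ s ≤ K₁) (hk₂ : ∀ s ∈ Icc a b, k s ≤ 2 → -K ≤ k₂ s)
    (hin : ∀ s ∈ Icc a b, ∀ t ∈ Icc a b, (x s - x t) * q s - (y s - y t) * p s
      ≤ (1 + δ ^ 2) * k s / 2 * ((x s - x t) ^ 2 + (y s - y t) ^ 2))
    (hsmall : (13 * (20 + K / 4) + K₁) * δ < 1) {r : ℝ} (hr : r ∈ Icc c b) :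
    k r ≤ 1 + (13 * (20 + K / 4) + K₁) * δ := by
  by_contra! hlt
  have hη : 0 ≤ (13 * (20 + K / 4) + K₁) * δ := by positivity
  obtain ⟨μ, hμ, hμ'⟩ := exists_between (lt_min hlt (show _ < (2 : ℝ) by linarith))
  obtain ⟨hμr, hμ2⟩ := lt_min_iff.1 hμ'
  have hsub : Icc c r ⊆ Icc a b := Icc_subset_Icc hc.1 hr.2
  have hcont : ContinuousOn k (Icc c r) := fun s hs =>
    (F.k_deriv s (hsub hs)).continuousAt.continuousWithinAt
  obtain ⟨m, ⟨hm, hkm⟩, hleast⟩ := (isCompact_Icc.of_isClosed_subset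
    (hcont.preimage_isClosed_of_isClosed isClosed_Icc isClosed_Ici)
    inter_subset_left : IsCompact (Icc c r ∩ k ⁻¹' Ici μ)).exists_isLeast
    ⟨r, right_mem_Icc.2 hr.1, hμr.le⟩
  have hkm : μ ≤ k m := hkm
  have hbelow : ∀ s ∈ Icc c m, s ≠ m → k s < μ := by
    intro s hs hne
    by_contra! hge
    exact hne (le_antisymm hs.2 (hleast ⟨⟨hs.1, hs.2.trans hm.2⟩, hge⟩))
  have hkm2 : k m ≤ μ := by
    by_contra! hgt
    obtain ⟨s, hs, hks⟩ := intermediate_value_Icc hm.1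
      (hcont.mono (Icc_subset_Icc_right hm.2)) ⟨by rw [hkc]; linarith, hkm⟩
    have hne : s ≠ m := by
      rintro rfl
      linarith
    linarith [hbelow s hs hne]
  have hle2 : ∀ s ∈ Icc c m, k s ≤ 2 := by
    intro s hs
    by_cases hne : s = m
    · subst hne
      linarith
    · linarith [hbelow s hs hne]
  have hsub' : Icc c m ⊆ Icc a b := (Icc_subset_Icc_right hm.2).trans hsub
  have growth : ∀ {u v D : ℝ}, u ≤ v → Icc u v ⊆ Icc c m → (∀ s ∈ Icc u v, k₁ s ≤ D) →
      k v - k u ≤ D * (v - u) := by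
    intro u v D huv huvm hD
    have := sub_le_sub_of_hasDerivAt_le huv (fun s hs => F.k_deriv s (hsub' (huvm hs)))
      (fun s _ => by simpa using (hasDerivAt_id s).const_mul D) hD
    linarith
  have hb₁ : ∀ s ∈ Icc c m, k₁ s ≤ K₁ := fun s hs => hk₁ s (hsub' hs) (hle2 s hs)
  rcases le_total c (m - δ) with hcm | hcm
  · have h1 := growth (D := K₁) (show m - δ ≤ m by linarith) (Icc_subset_Icc_left hcm)
      (fun s hs => hb₁ s (Icc_subset_Icc_left hcm hs))
    have h2 := growth (D := (20 + K / 4) * δ) hcm (Icc_subset_Icc_right (by linarith))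
      (fun s hs => by
        have hss : Icc s (s + δ) ⊆ Icc c m := Icc_subset_Icc hs.1 (by linarith [hs.2])
        exact (F.mono (hss.trans hsub')).curvature_deriv_le hδ hδ1
          (fun u hu => ⟨hk u (hsub' (hss hu)), hle2 u (hss hu)⟩)
          (fun u hu => hk₂ u (hsub' (hss hu)) (hle2 u (hss hu)))
          (hin s (hsub' (hss (left_mem_Icc.2 (by linarith)))) (s + δ)
            (hsub' (hss (right_mem_Icc.2 (by linarith))))))
    have h3 : (20 + K / 4) * δ * (m - δ - c) ≤ (20 + K / 4) * δ * 13 :=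
      mul_le_mul_of_nonneg_left (by linarith [hc.1, hm.2, hr.2]) (by positivity)
    nlinarith
  · have h1 := growth hm.1 Subset.rfl hb₁
    have h2 : K₁ * (m - c) ≤ K₁ * δ := mul_le_mul_of_nonneg_left (by linarith) hK₁
    nlinarith [mul_nonneg hK hδ.le]

/-- If the inscribed radius is everywhere almost the radius of curvature and the curvature is `1`
somewhere, then the curvature hardly exceeds `1`. -/
theorem curvature_le (F : FramedCurve a b x y p q k k₁ k₂) {c K₁ K δ : ℝ}
    (hlen : b - a ≤ 13) (hδ : 0 < δ) (hδ1 : δ ≤ 1) (hc : c ∈ Icc a b) (hkc : k c = 1)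
    (hk : ∀ s ∈ Icc a b, 0 < k s) (hK₁ : 0 ≤ K₁) (hK : 0 ≤ K)
    (hk₁ : ∀ s ∈ Icc a b, k s ≤ 2 → |k₁ s| ≤ K₁) (hk₂ : ∀ s ∈ Icc a b, k s ≤ 2 → |k₂ s| ≤ K)
    (hin : ∀ s ∈ Icc a b, ∀ t ∈ Icc a b, (x s - x t) * q s - (y s - y t) * p s
      ≤ (1 + δ ^ 2) * k s / 2 * ((x s - x t) ^ 2 + (y s - y t) ^ 2))
    (hsmall : (13 * (20 + K / 4) + K₁) * δ < 1) {r : ℝ} (hr : r ∈ Icc a b) :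
    k r ≤ 1 + (13 * (20 + K / 4) + K₁) * δ := by
  rcases le_total c r with hcr | hrc
  · exact F.curvature_le_forward hlen hδ hδ1 hc hkc hk hK₁ hK
      (fun s hs h => (abs_le.1 (hk₁ s hs h)).2) (fun s hs h => (abs_le.1 (hk₂ s hs h)).1)
      hin hsmall ⟨hcr, hr.2⟩
  · have hmem : ∀ s ∈ Icc (-b) (-a), -s ∈ Icc a b := fun s hs =>
      ⟨by linarith [hs.2], by linarith [hs.1]⟩
    have h := F.reflect.curvature_le_forward (c := -c) (r := -r) (K₁ := K₁) (K := K)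
      (by linarith) hδ hδ1 ⟨neg_le_neg hc.2, neg_le_neg hc.1⟩ (by simpa using hkc)
      (fun s hs => hk _ (hmem s hs)) hK₁ hK
      (fun s hs h => by linarith [(abs_le.1 (hk₁ _ (hmem s hs) h)).1])
      (fun s hs h => (abs_le.1 (hk₂ _ (hmem s hs) h)).1)
      (fun s hs t ht => by
        have := hin _ (hmem s hs) _ (hmem t ht)
        nlinarith)
      hsmall ⟨neg_le_neg hrc, neg_le_neg hr.1⟩
    simpa using h

end FramedCurve

/-- A unit-speed `C⁴` plane curve satisfies the Frenet equations. -/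
theorem framedCurve_of_unit_speed {γ : ℝ → ℝ × ℝ} {L : ℝ} (hL : 0 < L) (hγ : ContDiff ℝ 4 γ)
    (hunit : ∀ s ∈ Icc 0 L, nsq (deriv γ s) = 1) :
    FramedCurve 0 L (fun s => (γ s).1) (fun s => (γ s).2) (fun s => (deriv γ s).1)
      (fun s => (deriv γ s).2) (curv γ) (deriv (curv γ)) (deriv (deriv (curv γ))) := by
  have hγ1 : ContDiff ℝ 3 (deriv γ) :=
    (contDiff_succ_iff_deriv.1 (show ContDiff ℝ (3 + 1) γ by norm_num; exact hγ)).2.2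
  have hp : ContDiff ℝ (2 + 1) (fun s => (deriv γ s).1) := by
    norm_num
    exact hγ1.fst
  have hq : ContDiff ℝ (2 + 1) (fun s => (deriv γ s).2) := by
    norm_num
    exact hγ1.snd
  have hcurv : ContDiff ℝ (1 + 1) (curv γ) := by
    have hp2 := (contDiff_succ_iff_deriv.1 hp).2.2
    have hq2 := (contDiff_succ_iff_deriv.1 hq).2.2
    have h23 : (2 : WithTop ℕ∞) ≤ 2 + 1 := by norm_num
    norm_num
    exact ((hp.of_le h23).mul hq2).sub ((hq.of_le h23).mul hp2)
  have hcurv1 := (contDiff_succ_iff_deriv.1 hcurv).2.2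
  have hpd : ∀ s, HasDerivAt (fun s => (deriv γ s).1) (d2 γ s).1 s := fun s =>
    (hp.differentiable (by norm_num) s).hasDerivAt
  have hqd : ∀ s, HasDerivAt (fun s => (deriv γ s).2) (d2 γ s).2 s := fun s =>
    (hq.differentiable (by norm_num) s).hasDerivAt
  have hγd : ∀ s, HasDerivAt γ (deriv γ s) s := fun s =>
    (hγ.differentiable (by norm_num) s).hasDerivAt
  have horth : ∀ s ∈ Icc 0 L, (deriv γ s).1 * (d2 γ s).1 + (deriv γ s).2 * (d2 γ s).2 = 0 := by
    intro s hs
    have h1 := (((hpd s).fun_pow 2).fun_add ((hqd s).fun_pow 2)).hasDerivWithinAt (s := Icc 0 L)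
    have h2 : HasDerivWithinAt (fun s => (deriv γ s).1 ^ 2 + (deriv γ s).2 ^ 2) 0 (Icc 0 L) s :=
      (hasDerivWithinAt_const s (Icc 0 L) (1 : ℝ)).congr hunit (hunit s hs)
    have h3 := (uniqueDiffOn_Icc hL s hs).eq_deriv _ h1 h2
    norm_num at h3
    linarith
  constructor
  · exact fun s _ => (hγd s).fst
  · exact fun s _ => (hγd s).snd
  · intro s hs
    refine (hpd s).congr_deriv ?_
    have h1 := hunit s hs
    have h2 := horth s hs
    simp only [nsq] at h1
    simp only [curv]
    linear_combination (deriv γ s).1 * h2 - (d2 γ s).1 * h1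
  · intro s hs
    refine (hqd s).congr_deriv ?_
    have h1 := hunit s hs
    have h2 := horth s hs
    simp only [nsq] at h1
    simp only [curv]
    linear_combination (deriv γ s).2 * h2 - (d2 γ s).2 * h1
  · exact hunit
  · exact fun s _ => (hcurv.differentiable (by norm_num) s).hasDerivAt
  · exact fun s _ => (hcurv1.differentiable (by norm_num) s).hasDerivAt

/-- For a sequence of injective unit-speed `C⁴` curves `γ_j` on
`[0, L_j]` with `0 < L_j ≤ 4π`, positive curvature satisfying the derivative bounds
`|κ'| ≤ C#(κ + 2Θ)²` and `|κ''| ≤ C#(κ + 2Θ)³`, inscribed radius at least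
`1/((1+1/j)κ)` everywhere, and `κ_j(p_j) = 1` for some `p_j`, the suprema of the
curvatures converge to `1`. -/
theorem stmt2 (Csharp Θ : ℝ) (hC : 0 < Csharp) (hΘ : 0 < Θ)
    (L : ℕ → ℝ) (γ : ℕ → ℝ → ℝ × ℝ) (p : ℕ → ℝ)
    (hL : ∀ j : ℕ, 1 ≤ j → 0 < L j ∧ L j ≤ 4 * π)
    (hinj : ∀ j : ℕ, 1 ≤ j → Set.InjOn (γ j) (Icc 0 (L j)))
    (hsm : ∀ j : ℕ, 1 ≤ j → ContDiff ℝ 4 (γ j))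
    (hunit : ∀ j : ℕ, 1 ≤ j → ∀ s ∈ Icc 0 (L j), nsq (deriv (γ j) s) = 1)
    (hκpos : ∀ j : ℕ, 1 ≤ j → ∀ s ∈ Icc 0 (L j), 0 < curv (γ j) s)
    (hκ' : ∀ j : ℕ, 1 ≤ j → ∀ s ∈ Icc 0 (L j),
      |deriv (curv (γ j)) s| ≤ Csharp * (curv (γ j) s + 2 * Θ) ^ 2)
    (hκ'' : ∀ j : ℕ, 1 ≤ j → ∀ s ∈ Icc 0 (L j),
      |deriv (deriv (curv (γ j))) s| ≤ Csharp * (curv (γ j) s + 2 * Θ) ^ 3)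
    (hin : ∀ j : ℕ, 1 ≤ j → ∀ s ∈ Icc 0 (L j), ∀ t ∈ Icc 0 (L j),
      (1 + 1 / (j : ℝ)) * curv (γ j) s / 2 * nsq (γ j s - γ j t)
        - dot (γ j s - γ j t) (nor (γ j) s) ≥ 0)
    (hp : ∀ j : ℕ, 1 ≤ j → p j ∈ Icc 0 (L j) ∧ curv (γ j) (p j) = 1) :
    Tendsto (fun j : ℕ => sSup (curv (γ j) '' Icc 0 (L j))) atTop (nhds 1) := by
  set K₁ := Csharp * (2 + 2 * Θ) ^ 2
  set K := Csharp * (2 + 2 * Θ) ^ 3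
  have hK₁ : 0 ≤ K₁ := by positivity
  have hK : 0 ≤ K := by positivity
  set M := 13 * (20 + K / 4) + K₁
  have hlim : Tendsto (fun j : ℕ => M * √(1 / (j : ℝ))) atTop (nhds 0) := by
    simpa using (tendsto_one_div_atTop_nhds_zero_nat (𝕜 := ℝ)).sqrt.const_mul M
  have hupper : ∀ᶠ j : ℕ in atTop, 1 ≤ j ∧
      ∀ r ∈ Icc 0 (L j), curv (γ j) r ≤ 1 + M * √(1 / (j : ℝ)) := by
    filter_upwards [eventually_ge_atTop 1, hlim.eventually (gt_mem_nhds one_pos)] with j hj hsmall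
    refine ⟨hj, fun r hr => ?_⟩
    have hj' : (1 : ℝ) ≤ j := by exact_mod_cast hj
    have hpow : √(1 / (j : ℝ)) ^ 2 = 1 / (j : ℝ) := Real.sq_sqrt (by positivity)
    refine (framedCurve_of_unit_speed (hL j hj).1 (hsm j hj) (hunit j hj)).curvature_le
      (by linarith [(hL j hj).2, Real.pi_lt_d2]) (Real.sqrt_pos.2 (by positivity))
      (Real.sqrt_le_one.2 ((div_le_one (by linarith)).2 hj')) (hp j hj).1 (hp j hj).2
      (hκpos j hj) hK₁ hK ?_ ?_ ?_ hsmall hr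
    · intro s hs h2
      have := hκpos j hj s hs
      refine (hκ' j hj s hs).trans ?_
      exact mul_le_mul_of_nonneg_left (pow_le_pow_left₀ (by linarith) (by linarith) 2) hC.le
    · intro s hs h2
      have := hκpos j hj s hs
      refine (hκ'' j hj s hs).trans ?_
      exact mul_le_mul_of_nonneg_left (pow_le_pow_left₀ (by linarith) (by linarith) 3) hC.le
    · intro s hs t ht
      have := hin j hj s hs t ht
      simp only [nsq, dot, nor, Prod.fst_sub, Prod.snd_sub] at this
      rw [hpow]
      linarith
  have hlim1 : Tendsto (fun j : ℕ => 1 + M * √(1 / (j : ℝ))) atTop (nhds 1) := by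
    simpa using hlim.const_add 1
  refine tendsto_of_tendsto_of_tendsto_of_le_of_le' tendsto_const_nhds hlim1 ?_ ?_
  · filter_upwards [hupper] with j ⟨hj, hj'⟩
    exact le_csSup ⟨_, forall_mem_image.2 hj'⟩ ⟨p j, (hp j hj).1, (hp j hj).2⟩
  · filter_upwards [hupper] with j ⟨hj, hj'⟩
    exact csSup_le ⟨_, mem_image_of_mem _ (hp j hj).1⟩ (forall_mem_image.2 hj')

end
end

section
/- Fix α ∈ (0, 1/1000] and constants C# > 0, Θ > 0. For each j ∈ ℕ (j ≥ 1), let γ_j : [0, L_j] → ℝ² (L_j > 0) be an injective unit-speed curve of class C⁴ whose curvature κ_j satisfies κ_j(s) > 0, |κ_j'(s)| ≤ C#·(κ_j(s) + 2Θ)², and |κ_j''(s)| ≤ C#·(κ_j(s) + 2Θ)³ for all s ∈ [0, L_j]. Assume that for all s, t ∈ [0, L_j]: ((1 + 1/j)·κ_j(s)/2)·‖γ_j(s) − γ_j(t)‖² − ⟨γ_j(s) − γ_j(t), ν_j(s)⟩ ≥ 0 (inscribed radius at least 1/((1+1/j)·κ_j)) and (κ_j(s)/(2α))·‖γ_j(s)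 − γ_j(t)‖² + ⟨γ_j(s) − γ_j(t), ν_j(s)⟩ ≥ 0 (outer radius at least α/κ_j), and that κ_j(p_j) = 1 for some p_j ∈ [0, L_j]. Then there exists J such that L_j < 3π for all j ≥ J, and sup_{s ∈ [0, L_j]} |κ_j(s) − 1| → 0 as j → ∞. -/
open Real Set Filter

noncomputable section

/-- A unit-speed plane curve `(x, y)` with velocity `(c, d)` and curvature `k` on `S`. -/
structure FrenetOn (x y c d k : ℝ → ℝ) (S : Set ℝ) : Prop where
  hx : ∀ s ∈ S, HasDerivAt x (c s) s
  hy : ∀ s ∈ S, HasDerivAt y (d s) s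
  hc : ∀ s ∈ S, HasDerivAt c (-(k s * d s)) s
  hd : ∀ s ∈ S, HasDerivAt d (k s * c s) s
  unit : ∀ s ∈ S, c s ^ 2 + d s ^ 2 = 1

lemma FrenetOn.mono {x y c d k : ℝ → ℝ} {S S' : Set ℝ} (H : FrenetOn x y c d k S)
    (h : S' ⊆ S) : FrenetOn x y c d k S' :=
  ⟨fun s hs => H.hx s (h hs), fun s hs => H.hy s (h hs), fun s hs => H.hc s (h hs),
    fun s hs => H.hd s (h hs), fun s hs => H.unit s (h hs)⟩

lemma abs_sub_le_of_hasDerivAt {f f' : ℝ → ℝ} {a b B s t : ℝ}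
    (hf : ∀ u ∈ Icc a b, HasDerivAt f (f' u) u) (hB : ∀ u ∈ Icc a b, |f' u| ≤ B)
    (hs : s ∈ Icc a b) (ht : t ∈ Icc a b) : |f t - f s| ≤ B * |t - s| :=
  Convex.norm_image_sub_le_of_norm_hasDerivWithin_le
    (fun u hu => (hf u hu).hasDerivWithinAt) hB (convex_Icc a b) hs ht

lemma le_of_hasDerivAt_le {f f' g g' : ℝ → ℝ} {h : ℝ}
    (hf : ∀ u ∈ Icc 0 h, HasDerivAt f (f' u) u) (hg : ∀ u ∈ Icc 0 h, HasDerivAt g (g' u) u)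
    (h0 : f 0 ≤ g 0) (hle : ∀ u ∈ Icc 0 h, f' u ≤ g' u) : ∀ u ∈ Icc 0 h, f u ≤ g u :=
  fun _ hu => image_le_of_deriv_right_le_deriv_boundary
    (fun u hu => (hf u hu).continuousAt.continuousWithinAt)
    (fun u hu => (hf u (Ico_subset_Icc_self hu)).hasDerivWithinAt) h0
    (fun u hu => (hg u hu).continuousAt.continuousWithinAt)
    (fun u hu => (hg u (Ico_subset_Icc_self hu)).hasDerivWithinAt)
    (fun u hu => hle u (Ico_subset_Icc_self hu)) hu

lemma le_quartic_of_third_deriv_le {f f1 f2 f3 : ℝ → ℝ} {h A M : ℝ} (hh : 0 ≤ h)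
    (hf : ∀ u ∈ Icc 0 h, HasDerivAt f (f1 u) u) (hf1 : ∀ u ∈ Icc 0 h, HasDerivAt f1 (f2 u) u)
    (hf2 : ∀ u ∈ Icc 0 h, HasDerivAt f2 (f3 u) u)
    (h0 : f 0 = 0) (h1 : f1 0 = 0) (h2 : f2 0 = 0)
    (h3 : ∀ u ∈ Icc 0 h, f3 u ≤ A + M * u) :
    f h ≤ A * h ^ 3 / 6 + M * h ^ 4 / 24 := by
  have e2 := le_of_hasDerivAt_le (g := fun u => A * u + M * u ^ 2 / 2) hf2
    (fun u _ => by
      refine (((hasDerivAt_id u).const_mul A).add ((((hasDerivAt_id u).pow 2).const_mul M).div_const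
        2)).congr_deriv ?_
      simp; ring) (by simp [h2]) h3
  have e1 := le_of_hasDerivAt_le (g := fun u => A * u ^ 2 / 2 + M * u ^ 3 / 6) hf1
    (fun u _ => by
      refine (((((hasDerivAt_id u).pow 2).const_mul A).div_const 2).add
        ((((hasDerivAt_id u).pow 3).const_mul M).div_const 6)).congr_deriv ?_
      simp; ring) (by simp [h1]) e2
  exact le_of_hasDerivAt_le (g := fun u => A * u ^ 3 / 6 + M * u ^ 4 / 24) hf
    (fun u _ => by
      refine (((((hasDerivAt_id u).pow 3).const_mul A).div_const 6).add
        ((((hasDerivAt_id u).pow 4).const_mul M).div_const 24)).congr_deriv ?_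
      simp; ring) (by simp [h0]) e1 h ⟨hh, le_rfl⟩

lemma abs_dot_le_one {a b c d : ℝ} (h : a ^ 2 + b ^ 2 = 1) (h' : c ^ 2 + d ^ 2 = 1) :
    |a * c + b * d| ≤ 1 := by
  rw [abs_le]
  constructor <;> nlinarith [sq_nonneg (a - c), sq_nonneg (b - d), sq_nonneg (a + c),
    sq_nonneg (b + d)]

lemma abs_mul_add_mul_le {p q c d r : ℝ} (hp : |p| ≤ r) (hq : |q| ≤ r)
    (h : c ^ 2 + d ^ 2 = 1) : |p * c + q * d| ≤ 2 * r := by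
  have hc : |c| ≤ 1 := abs_le_one_iff_mul_self_le_one.2 (by nlinarith [sq_nonneg d])
  have hd : |d| ≤ 1 := abs_le_one_iff_mul_self_le_one.2 (by nlinarith [sq_nonneg c])
  calc |p * c + q * d| ≤ |p * c| + |q * d| := abs_add_le _ _
    _ ≤ r * 1 + r * 1 := by
      rw [abs_mul, abs_mul]
      have := (abs_nonneg p).trans hp
      gcongr
    _ = 2 * r := by ring

/-- Third-order control of the osculating-circle defect. -/
lemma FrenetOn.abs_third_deriv_le {x y c d k k1 k2 : ℝ → ℝ} {a b K1 K2 s t : ℝ}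
    (H : FrenetOn x y c d k (Icc a b))
    (hk1 : ∀ u ∈ Icc a b, HasDerivAt k1 (k2 u) u)
    (kb : ∀ u ∈ Icc a b, |k u| ≤ 2) (k1b : ∀ u ∈ Icc a b, |k1 u| ≤ K1)
    (k2b : ∀ u ∈ Icc a b, |k2 u| ≤ K2) (hs : s ∈ Icc a b) (ht : t ∈ Icc a b) :
    |(-(k s * (k1 t * ((x t - x s) * d t + (y t - y s) * -c t)
        + k t ^ 2 * ((x t - x s) * c t + (y t - y s) * d t)))
      - k1 t * (d t * d s + c t * c s) - k t ^ 2 * (c t * d s + d t * -c s)) + k1 s|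
      ≤ (6 * K1 + K2 + 24) * |t - s| := by
  set r := |t - s| with hr
  have hr0 : 0 ≤ r := abs_nonneg _
  have hK1 : 0 ≤ K1 := (abs_nonneg _).trans (k1b s hs)
  have ab1 : ∀ {p q : ℝ}, p ^ 2 + q ^ 2 = 1 → |p| ≤ 1 := fun {p q} h =>
    abs_le_one_iff_mul_self_le_one.2 (by nlinarith [sq_nonneg q])
  have hX : |x t - x s| ≤ r := by
    simpa using abs_sub_le_of_hasDerivAt H.hx (fun u hu => ab1 (H.unit u hu)) hs ht
  have hY : |y t - y s| ≤ r := by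
    simpa using abs_sub_le_of_hasDerivAt H.hy
      (fun u hu => ab1 ((add_comm _ _).trans (H.unit u hu))) hs ht
  have us := H.unit s hs
  have ut := H.unit t ht
  have q1 : |(x t - x s) * d t + (y t - y s) * -c t| ≤ 2 * r :=
    abs_mul_add_mul_le hX hY (by linarith [neg_sq (c t)])
  have q2 : |(x t - x s) * c t + (y t - y s) * d t| ≤ 2 * r := abs_mul_add_mul_le hX hY ut
  have q3 : |c t * d s + d t * -c s| ≤ 2 * r := by
    have := abs_sub_le_of_hasDerivAt (f := fun u => c u * d s + d u * -c s)
      (f' := fun u => -(k u * (d u * d s + c u * c s))) (B := 2)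
      (fun u hu => by
        exact (((H.hc u hu).mul_const (d s)).add ((H.hd u hu).mul_const (-c s))).congr_deriv (by ring))
      (fun u hu => by
        rw [abs_neg, abs_mul]
        have h1 := abs_dot_le_one (a := d u) (b := c u) (c := d s) (d := c s)
          (by linarith [H.unit u hu]) (by linarith)
        nlinarith [kb u hu, abs_nonneg (k u), abs_nonneg (d u * d s + c u * c s)]) hs ht
    rwa [show c s * d s + d s * -c s = 0 by ring, sub_zero] at this
  have q4 : |(d t * d s + c t * c s) - 1| ≤ 2 * r := by
    have := abs_sub_le_of_hasDerivAt (f := fun u => d u * d s + c u * c s)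
      (f' := fun u => k u * (c u * d s + d u * -c s)) (B := 2)
      (fun u hu => by
        exact (((H.hd u hu).mul_const (d s)).add ((H.hc u hu).mul_const (c s))).congr_deriv (by ring))
      (fun u hu => by
        rw [abs_mul]
        have h1 := abs_dot_le_one (a := c u) (b := d u) (c := d s) (d := -c s)
          (H.unit u hu) (by linarith [neg_sq (c s)])
        nlinarith [kb u hu, abs_nonneg (k u), abs_nonneg (c u * d s + d u * -c s)]) hs ht
    rwa [show d s * d s + c s * c s = 1 by linarith [sq (d s), sq (c s)]] at this
  have q5 : |k1 t - k1 s| ≤ K2 * r := abs_sub_le_of_hasDerivAt hk1 k2b hs ht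
  have bs := kb s hs
  have bt : |k t ^ 2| ≤ 4 := by
    rw [abs_pow]; nlinarith [kb t ht, abs_nonneg (k t)]
  have b1 := k1b t ht
  generalize (x t - x s) * d t + (y t - y s) * -c t = Q1 at *
  generalize (x t - x s) * c t + (y t - y s) * d t = Q2 at *
  generalize c t * d s + d t * -c s = Q3 at *
  generalize d t * d s + c t * c s = Q4 at *
  have e : (-(k s * (k1 t * Q1 + k t ^ 2 * Q2)) - k1 t * Q4 - k t ^ 2 * Q3) + k1 s
      = -(k s * (k1 t * Q1)) + -(k s * (k t ^ 2 * Q2)) + -(k1 t * (Q4 - 1))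
        + -(k t ^ 2 * Q3) + -(k1 t - k1 s) := by ring
  rw [e]
  have t1 : |k s * (k1 t * Q1)| ≤ 2 * (K1 * (2 * r)) := by rw [abs_mul, abs_mul]; gcongr
  have t2 : |k s * (k t ^ 2 * Q2)| ≤ 2 * (4 * (2 * r)) := by rw [abs_mul, abs_mul]; gcongr
  have t3 : |k1 t * (Q4 - 1)| ≤ K1 * (2 * r) := by rw [abs_mul]; gcongr
  have t4 : |k t ^ 2 * Q3| ≤ 4 * (2 * r) := by rw [abs_mul]; gcongr
  rw [abs_le] at *
  constructor <;> linarith [t1.1, t1.2, t2.1, t2.2, t3.1, t3.2, t4.1, t4.2, q5.1, q5.2]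

/-- The inscribed-radius inequality at `s`, tested at `s + σ h` with `σ = ± 1`, bounds
`σ k'(s)` from above. -/
lemma FrenetOn.signed_deriv_le {x y c d k k1 k2 : ℝ → ℝ} {a b K1 K2 s σ h ε : ℝ}
    (H : FrenetOn x y c d k (Icc a b))
    (hk : ∀ u ∈ Icc a b, HasDerivAt k (k1 u) u) (hk1 : ∀ u ∈ Icc a b, HasDerivAt k1 (k2 u) u)
    (kb : ∀ u ∈ Icc a b, |k u| ≤ 2) (k1b : ∀ u ∈ Icc a b, |k1 u| ≤ K1)
    (k2b : ∀ u ∈ Icc a b, |k2 u| ≤ K2) (hσ : |σ| = 1) (hh : 0 < h) (hε : 0 ≤ ε)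
    (hs : s ∈ Icc a b) (ht : s + σ * h ∈ Icc a b)
    (hin : 0 ≤ (1 + ε) * k s / 2 * ((x (s + σ * h) - x s) ^ 2 + (y (s + σ * h) - y s) ^ 2)
      + ((x (s + σ * h) - x s) * d s + (y (s + σ * h) - y s) * -c s)) :
    σ * k1 s ≤ 12 * ε / h + (6 * K1 + K2 + 24) * h / 4 := by
  have hσ2 : σ ^ 2 = 1 := by rw [← sq_abs, hσ, one_pow]
  have hmem : ∀ u ∈ Icc 0 h, s + σ * u ∈ Icc a b := fun u hu => by
    rcases eq_or_eq_neg_of_abs_eq hσ with rfl | rfl <;>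
      constructor <;> linarith [hu.1, hu.2, hs.1, hs.2, ht.1, ht.2]
  have comp : ∀ {g g' : ℝ → ℝ}, (∀ u ∈ Icc a b, HasDerivAt g (g' u) u) → ∀ u ∈ Icc 0 h,
      HasDerivAt (fun u => g (s + σ * u)) (σ * g' (s + σ * u)) u := fun {g g'} hg u hu => by
    have h1 : HasDerivAt (fun u => s + σ * u) σ u := by
      simpa using ((hasDerivAt_id u).const_mul σ).const_add s
    simpa [Function.comp_def, mul_comm] using (hg _ (hmem u hu)).comp u h1
  have key := le_quartic_of_third_deriv_le (A := -(σ * k1 s)) (M := 6 * K1 + K2 + 24) hh.le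
    (f := fun u => k s / 2 * ((x (s + σ * u) - x s) ^ 2 + (y (s + σ * u) - y s) ^ 2)
      + ((x (s + σ * u) - x s) * d s + (y (s + σ * u) - y s) * -c s))
    (f1 := fun u => σ * (k s * ((x (s + σ * u) - x s) * c (s + σ * u)
      + (y (s + σ * u) - y s) * d (s + σ * u)) + (c (s + σ * u) * d s + d (s + σ * u) * -c s)))
    (f2 := fun u => k s * (1 - k (s + σ * u) * ((x (s + σ * u) - x s) * d (s + σ * u)
      + (y (s + σ * u) - y s) * -c (s + σ * u)))
      - k (s + σ * u) * (d (s + σ * u) * d s + c (s + σ * u) * c s))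
    (f3 := fun u => σ * (-(k s * (k1 (s + σ * u) * ((x (s + σ * u) - x s) * d (s + σ * u)
        + (y (s + σ * u) - y s) * -c (s + σ * u))
        + k (s + σ * u) ^ 2 * ((x (s + σ * u) - x s) * c (s + σ * u)
        + (y (s + σ * u) - y s) * d (s + σ * u))))
      - k1 (s + σ * u) * (d (s + σ * u) * d s + c (s + σ * u) * c s)
      - k (s + σ * u) ^ 2 * (c (s + σ * u) * d s + d (s + σ * u) * -c s)))
    (fun u hu => by
      have X := (comp H.hx u hu).sub_const (x s)
      have Y := (comp H.hy u hu).sub_const (y s)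
      refine (((X.pow 2).add (Y.pow 2)).const_mul (k s / 2) |>.add
        ((X.mul_const (d s)).add (Y.mul_const (-c s)))).congr_deriv ?_
      simp; ring)
    (fun u hu => by
      have X := (comp H.hx u hu).sub_const (x s)
      have Y := (comp H.hy u hu).sub_const (y s)
      have C := comp H.hc u hu
      have D := comp H.hd u hu
      refine ((((X.mul C).add (Y.mul D)).const_mul (k s)).add
        ((C.mul_const (d s)).add (D.mul_const (-c s))) |>.const_mul σ).congr_deriv ?_
      have U := H.unit _ (hmem u hu)
      linear_combination (σ ^ 2 * k s) * U
        + (k s * (1 - k (s + σ * u) * ((x (s + σ * u) - x s) * d (s + σ * u)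
      + (y (s + σ * u) - y s) * -c (s + σ * u)))
      - k (s + σ * u) * (d (s + σ * u) * d s + c (s + σ * u) * c s)) * hσ2)
    (fun u hu => by
      have X := (comp H.hx u hu).sub_const (x s)
      have Y := (comp H.hy u hu).sub_const (y s)
      have C := comp H.hc u hu
      have D := comp H.hd u hu
      have K := comp hk u hu
      refine ((((K.mul ((X.mul D).add (Y.mul C.neg))).const_sub 1).const_mul (k s)).sub
        (K.mul ((D.mul_const (d s)).add (C.mul_const (c s))))).congr_deriv ?_
      simp; ring)
    (by simp) (by simp; ring_nf; simp)
    (by have := H.unit s hs; simp; linear_combination (-k s) * this)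
    (fun u hu => by
      have h3 := H.abs_third_deriv_le hk1 kb k1b k2b hs (hmem u hu)
      rw [add_sub_cancel_left, abs_mul, hσ, one_mul, abs_of_nonneg hu.1] at h3
      have h4 : ∀ E : ℝ, |E + k1 s| ≤ (6 * K1 + K2 + 24) * u →
          σ * E ≤ -(σ * k1 s) + (6 * K1 + K2 + 24) * u := fun E hE => by
        have h5 := le_abs_self (σ * (E + k1 s))
        rw [abs_mul, hσ, one_mul] at h5
        linarith
      exact h4 _ h3)
  have ab1 : ∀ {p q : ℝ}, p ^ 2 + q ^ 2 = 1 → |p| ≤ 1 := fun {p q} h =>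
    abs_le_one_iff_mul_self_le_one.2 (by nlinarith [sq_nonneg q])
  have hX := abs_sub_le_of_hasDerivAt H.hx (fun u hu => ab1 (H.unit u hu)) hs ht
  have hY := abs_sub_le_of_hasDerivAt H.hy
    (fun u hu => ab1 ((add_comm _ _).trans (H.unit u hu))) hs ht
  rw [add_sub_cancel_left, abs_mul, hσ, abs_of_pos hh, one_mul, one_mul] at hX hY
  have hX2 := sq_le_sq.2 (hX.trans (le_abs_self h))
  have hY2 := sq_le_sq.2 (hY.trans (le_abs_self h))
  have hks := (le_abs_self _).trans (kb s hs)
  have hw : ε * (k s / 2 * ((x (s + σ * h) - x s) ^ 2 + (y (s + σ * h) - y s) ^ 2))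
      ≤ ε * (2 * h ^ 2) := by
    refine mul_le_mul_of_nonneg_left ?_ hε
    nlinarith [mul_nonneg (sub_nonneg.2 hks) (add_nonneg (sq_nonneg (x (s + σ * h) - x s))
      (sq_nonneg (y (s + σ * h) - y s)))]
  have fin : σ * k1 s * (h ^ 3 / 6) ≤ (12 * ε / h + (6 * K1 + K2 + 24) * h / 4) * (h ^ 3 / 6) := by
    have : (12 * ε / h + (6 * K1 + K2 + 24) * h / 4) * (h ^ 3 / 6)
        = ε * (2 * h ^ 2) + (6 * K1 + K2 + 24) * h ^ 4 / 24 := by field_simp; ring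
    rw [this]
    linarith
  exact le_of_mul_le_mul_right fin (by positivity)

lemma FrenetOn.abs_deriv_le {x y c d k k1 k2 : ℝ → ℝ} {a b K1 K2 h ε : ℝ}
    (H : FrenetOn x y c d k (Icc a b))
    (hk : ∀ u ∈ Icc a b, HasDerivAt k (k1 u) u) (hk1 : ∀ u ∈ Icc a b, HasDerivAt k1 (k2 u) u)
    (kb : ∀ u ∈ Icc a b, |k u| ≤ 2) (k1b : ∀ u ∈ Icc a b, |k1 u| ≤ K1)
    (k2b : ∀ u ∈ Icc a b, |k2 u| ≤ K2) (hh : 0 < h) (hε : 0 ≤ ε)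
    (hin : ∀ s ∈ Icc a b, ∀ t ∈ Icc a b, 0 ≤ (1 + ε) * k s / 2 *
      ((x t - x s) ^ 2 + (y t - y s) ^ 2) + ((x t - x s) * d s + (y t - y s) * -c s))
    (hab : 2 * h ≤ b - a) {s : ℝ} (hs : s ∈ Icc a b) :
    |k1 s| ≤ 12 * ε / h + (6 * K1 + K2 + 24) * h / 4 + K2 * h := by
  have mid : ∀ u ∈ Icc (a + h) (b - h), |k1 u| ≤ 12 * ε / h + (6 * K1 + K2 + 24) * h / 4 := by
    intro u hu
    have hu' : u ∈ Icc a b := ⟨by linarith [hu.1], by linarith [hu.2]⟩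
    have hr : u + 1 * h ∈ Icc a b := ⟨by linarith [hu.1], by linarith [hu.2]⟩
    have hl : u + -1 * h ∈ Icc a b := ⟨by linarith [hu.1], by linarith [hu.2]⟩
    have e1 := H.signed_deriv_le hk hk1 kb k1b k2b (abs_one) hh hε hu' hr (hin u hu' _ hr)
    have e2 := H.signed_deriv_le hk hk1 kb k1b k2b (by simp) hh hε hu' hl (hin u hu' _ hl)
    exact abs_le'.2 ⟨by linarith, by linarith⟩
  obtain ⟨u, hu, hus⟩ : ∃ u ∈ Icc (a + h) (b - h), |s - u| ≤ h := by
    refine ⟨max (a + h) (min s (b - h)), ⟨le_max_left _ _, max_le (by linarith)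
      (min_le_right _ _)⟩, abs_le.2 ?_⟩
    rcases le_total s (b - h) with h1 | h1
    · rw [min_eq_left h1]
      rcases le_total (a + h) s with h2 | h2
      · rw [max_eq_right h2]; constructor <;> linarith
      · rw [max_eq_left h2]; constructor <;> linarith [hs.1]
    · rw [min_eq_right h1, max_eq_right (by linarith)]
      constructor <;> linarith [hs.2]
  have hu' : u ∈ Icc a b := ⟨by linarith [hu.1], by linarith [hu.2]⟩
  have hK2 : 0 ≤ K2 := (abs_nonneg _).trans (k2b s hs)
  have e1 := abs_sub_le_of_hasDerivAt hk1 k2b hu' hs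
  have e2 := mul_le_mul_of_nonneg_left hus hK2
  have e3 := abs_sub_abs_le_abs_sub (k1 s) (k1 u)
  linarith [mid u hu]

lemma three_pi_lt_ten : 3 * π < 10 := by linarith [pi_lt_d2]

/-- The bound on `|k - 1|` obtained by testing at distance `h`. -/
def curvDefect (K1 K2 ε h : ℝ) : ℝ :=
  10 * (12 * ε / h + (6 * K1 + K2 + 24) * h / 4 + K2 * h) + 2 * h * K1

lemma FrenetOn.abs_sub_one_le_curvDefect {x y c d k k1 k2 : ℝ → ℝ} {a b K1 K2 h ε p : ℝ}
    (H : FrenetOn x y c d k (Icc a b))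
    (hk : ∀ u ∈ Icc a b, HasDerivAt k (k1 u) u) (hk1 : ∀ u ∈ Icc a b, HasDerivAt k1 (k2 u) u)
    (kb : ∀ u ∈ Icc a b, |k u| ≤ 2) (k1b : ∀ u ∈ Icc a b, |k1 u| ≤ K1)
    (k2b : ∀ u ∈ Icc a b, |k2 u| ≤ K2) (hh : 0 < h) (hε : 0 ≤ ε)
    (hin : ∀ s ∈ Icc a b, ∀ t ∈ Icc a b, 0 ≤ (1 + ε) * k s / 2 *
      ((x t - x s) ^ 2 + (y t - y s) ^ 2) + ((x t - x s) * d s + (y t - y s) * -c s))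
    (hab : b - a ≤ 3 * π) (hp : p ∈ Icc a b) (hkp : k p = 1) {s : ℝ} (hs : s ∈ Icc a b) :
    |k s - 1| ≤ curvDefect K1 K2 ε h := by
  have hK1 : 0 ≤ K1 := (abs_nonneg _).trans (k1b s hs)
  have hK2 : 0 ≤ K2 := (abs_nonneg _).trans (k2b s hs)
  have hsp : |s - p| ≤ b - a :=
    abs_le.2 ⟨by linarith [hs.1, hp.2], by linarith [hs.2, hp.1]⟩
  unfold curvDefect
  rw [← hkp]
  rcases le_total (2 * h) (b - a) with h1 | h1
  · have e := abs_sub_le_of_hasDerivAt hk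
      (fun u hu => H.abs_deriv_le hk hk1 kb k1b k2b hh hε hin h1 hu) hp hs
    have h10 : |s - p| ≤ 10 := by linarith [three_pi_lt_ten]
    have hB : 0 ≤ 12 * ε / h + (6 * K1 + K2 + 24) * h / 4 + K2 * h := by positivity
    have e2 := mul_le_mul_of_nonneg_left h10 hB
    have : 0 ≤ 2 * h * K1 := by positivity
    linarith
  · have e := abs_sub_le_of_hasDerivAt hk k1b hp hs
    have e2 := mul_le_mul_of_nonneg_left (hsp.trans h1) hK1
    have hB : 0 ≤ 10 * (12 * ε / h + (6 * K1 + K2 + 24) * h / 4 + K2 * h) := by positivity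
    linarith

/-- Removes the a priori upper bound on the curvature by a continuity argument. -/
lemma FrenetOn.abs_sub_one_le {x y c d k k1 k2 : ℝ → ℝ} {a b C Θ h ε p : ℝ}
    (H : FrenetOn x y c d k (Icc a b))
    (hk : ∀ u ∈ Icc a b, HasDerivAt k (k1 u) u) (hk1 : ∀ u ∈ Icc a b, HasDerivAt k1 (k2 u) u)
    (hC : 0 ≤ C) (hΘ : 0 ≤ Θ) (kpos : ∀ u ∈ Icc a b, 0 < k u)
    (k1b : ∀ u ∈ Icc a b, |k1 u| ≤ C * (k u + 2 * Θ) ^ 2)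
    (k2b : ∀ u ∈ Icc a b, |k2 u| ≤ C * (k u + 2 * Θ) ^ 3) (hh : 0 < h) (hε : 0 ≤ ε)
    (hin : ∀ s ∈ Icc a b, ∀ t ∈ Icc a b, 0 ≤ (1 + ε) * k s / 2 *
      ((x t - x s) ^ 2 + (y t - y s) ^ 2) + ((x t - x s) * d s + (y t - y s) * -c s))
    (hab : b - a ≤ 3 * π) (hp : p ∈ Icc a b) (hkp : k p = 1)
    (hD : curvDefect (C * (2 + 2 * Θ) ^ 2) (C * (2 + 2 * Θ) ^ 3) ε h ≤ 1 / 2)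
    {s : ℝ} (hs : s ∈ Icc a b) :
    |k s - 1| ≤ curvDefect (C * (2 + 2 * Θ) ^ 2) (C * (2 + 2 * Θ) ^ 3) ε h := by
  have claim : ∀ a' b', Icc a' b' ⊆ Icc a b → b' - a' ≤ b - a → p ∈ Icc a' b' →
      (∀ u ∈ Icc a' b', k u ≤ 2) → ∀ u ∈ Icc a' b',
      |k u - 1| ≤ curvDefect (C * (2 + 2 * Θ) ^ 2) (C * (2 + 2 * Θ) ^ 3) ε h := by
    intro a' b' hsub hlen hp' h2 u hu
    refine (H.mono hsub).abs_sub_one_le_curvDefect (fun u hu => hk u (hsub hu))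
      (fun u hu => hk1 u (hsub hu)) (fun u hu => ?_) (fun u hu => ?_) (fun u hu => ?_) hh hε
      (fun s hs t ht => hin s (hsub hs) t (hsub ht)) (hlen.trans hab) hp' hkp hu
    · rw [abs_of_pos (kpos u (hsub hu))]; exact h2 u hu
    · have := kpos u (hsub hu)
      have := h2 u hu
      refine (k1b u (hsub hu)).trans ?_
      gcongr
    · have := kpos u (hsub hu)
      have := h2 u hu
      refine (k2b u (hsub hu)).trans ?_
      gcongr
  have hlt : ∀ u ∈ Icc a b, k u < 2 := by
    by_contra! hne
    obtain ⟨u₁, hu₁, hu₁'⟩ := hne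
    have hcont : ContinuousOn k (Icc a b) := fun u hu => (hk u hu).continuousAt.continuousWithinAt
    have hcomp : IsCompact (Icc a b ∩ k ⁻¹' Ici 2) :=
      isCompact_Icc.of_isClosed_subset (hcont.preimage_isClosed_of_isClosed isClosed_Icc isClosed_Ici)
        inter_subset_left
    obtain ⟨v, ⟨hv, hv2⟩, hmin⟩ := hcomp.exists_isMinOn ⟨u₁, hu₁, hu₁'⟩
      (f := fun u => |u - p|) (by fun_prop)
    have hnear : ∀ u ∈ Icc a b, |u - p| < |v - p| → k u < 2 := fun u hu h' => by
      by_contra! h2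
      exact absurd (hmin ⟨hu, h2⟩) (not_le.2 h')
    have hsub : Icc (min p v) (max p v) ⊆ Icc a b :=
      Icc_subset_Icc (le_min hp.1 hv.1) (max_le hp.2 hv.2)
    have hinside : ∀ u ∈ Icc (min p v) (max p v), u ≠ v → k u < 2 := fun u hu huv => by
      refine hnear u (hsub hu) ?_
      rcases le_total p v with h1 | h1
      · rw [min_eq_left h1, max_eq_right h1] at hu
        rw [abs_of_nonneg (by linarith [hu.1]), abs_of_nonneg (by linarith)]
        linarith [lt_of_le_of_ne hu.2 huv]
      · rw [min_eq_right h1, max_eq_left h1] at hu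
        rw [abs_of_nonpos (by linarith [hu.2]), abs_of_nonpos (by linarith)]
        linarith [lt_of_le_of_ne hu.1 huv.symm]
    have hpv : p ≠ v := by
      rintro rfl
      have : (2 : ℝ) ≤ k p := hv2
      linarith
    have hv2' : k v = 2 := by
      refine le_antisymm ?_ hv2
      by_contra! hgt
      obtain ⟨w, hw, hw2⟩ := intermediate_value_uIcc
        (hcont.mono (show uIcc p v ⊆ Icc a b from hsub))
        (show (2 : ℝ) ∈ uIcc (k p) (k v) by
          rw [hkp, uIcc_of_le (by linarith)]; exact ⟨by norm_num, hgt.le⟩)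
      rcases eq_or_ne w v with rfl | hwv
      · exact hgt.ne' hw2
      · exact (hinside w hw hwv).ne hw2
    have := claim _ _ hsub (by
        have := hsub (left_mem_Icc.2 (min_le_max (a := p) (b := v)))
        have := hsub (right_mem_Icc.2 (min_le_max (a := p) (b := v)))
        linarith [this.2, ‹min p v ∈ Icc a b›.1]) ⟨min_le_left _ _, le_max_left _ _⟩
      (fun u hu => by
        rcases eq_or_ne u v with rfl | huv
        · exact hv2'.le
        · exact (hinside u hu huv).le) v ⟨min_le_right _ _, le_max_right _ _⟩
    rw [hv2'] at this
    norm_num at this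
    linarith
  exact claim a b Subset.rfl le_rfl hp (fun u hu => (hlt u hu).le) s hs

/-- A curve of length `3π` with curvature near `1` follows the unit circle. -/
lemma FrenetOn.abs_sub_circle_le {x y c d k : ℝ → ℝ} {a δ t : ℝ}
    (H : FrenetOn x y c d k (Icc a (a + 3 * π)))
    (hδ : ∀ u ∈ Icc a (a + 3 * π), |k u - 1| ≤ δ) (ht : t ∈ Icc a (a + 3 * π)) :
    |(x t - x a) - (c a * sin (t - a) - d a * (1 - cos (t - a)))| ≤ 200 * δ ∧
    |(y t - y a) - (c a * (1 - cos (t - a)) + d a * sin (t - a))| ≤ 200 * δ := by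
  have hδ0 : 0 ≤ δ := (abs_nonneg _).trans (hδ t ht)
  have ha : a ∈ Icc a (a + 3 * π) := ⟨le_rfl, by linarith [pi_pos]⟩
  have h10 : ∀ u ∈ Icc a (a + 3 * π), |u - a| ≤ 10 := fun u hu =>
    abs_le.2 ⟨by linarith [hu.1], by linarith [hu.2, three_pi_lt_ten]⟩
  have hsin : ∀ u, HasDerivAt (fun u => sin (u - a)) (cos (u - a)) u := fun u => by
    simpa using ((hasDerivAt_id u).sub_const a).sin
  have hcos : ∀ u, HasDerivAt (fun u => cos (u - a)) (-sin (u - a)) u := fun u => by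
    simpa using ((hasDerivAt_id u).sub_const a).cos
  have rot : ∀ u ∈ Icc a (a + 3 * π), ∀ P, |P| ≤ 1 → |(k u - 1) * P| ≤ δ := fun u hu P hP => by
    rw [abs_mul]
    nlinarith [hδ u hu, abs_nonneg (k u - 1), abs_nonneg P]
  have hu : ∀ u ∈ Icc a (a + 3 * π),
      |(c u * cos (u - a) + d u * sin (u - a)) - c a| ≤ 10 * δ := fun u hu => by
    have := abs_sub_le_of_hasDerivAt (f := fun u => c u * cos (u - a) + d u * sin (u - a))
      (f' := fun u => (k u - 1) * (c u * sin (u - a) + d u * -cos (u - a))) (B := δ)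
      (fun u hu => (((H.hc u hu).mul (hcos u)).add ((H.hd u hu).mul (hsin u))).congr_deriv (by ring))
      (fun u hu => rot u hu _ (abs_dot_le_one (H.unit u hu) (by
        rw [neg_sq]; exact sin_sq_add_cos_sq _))) ha hu
    simp only [sub_self, cos_zero, sin_zero, mul_one, mul_zero, add_zero] at this
    nlinarith [h10 u hu]
  have hv : ∀ u ∈ Icc a (a + 3 * π),
      |(c u * -sin (u - a) + d u * cos (u - a)) - d a| ≤ 10 * δ := fun u hu => by
    have := abs_sub_le_of_hasDerivAt (f := fun u => c u * -sin (u - a) + d u * cos (u - a))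
      (f' := fun u => (k u - 1) * (c u * cos (u - a) + d u * sin (u - a))) (B := δ)
      (fun u hu => (((H.hc u hu).mul (hsin u).neg).add
        ((H.hd u hu).mul (hcos u))).congr_deriv (by simp; ring))
      (fun u hu => rot u hu _ (abs_dot_le_one (H.unit u hu) (cos_sq_add_sin_sq _))) ha hu
    simp only [sub_self, cos_zero, sin_zero, mul_one, mul_zero, zero_add, neg_zero] at this
    nlinarith [h10 u hu]
  constructor
  · have := abs_sub_le_of_hasDerivAt
      (f := fun u => x u - (c a * sin (u - a) - d a * (1 - cos (u - a))))
      (f' := fun u => ((c u * cos (u - a) + d u * sin (u - a)) - c a) * cos (u - a)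
        + ((c u * -sin (u - a) + d u * cos (u - a)) - d a) * -sin (u - a)) (B := 2 * (10 * δ))
      (fun u hu => ((H.hx u hu).sub (((hsin u).const_mul (c a)).sub
        (((hcos u).const_sub 1).const_mul (d a)))).congr_deriv (by
          linear_combination (-c u) * sin_sq_add_cos_sq (u - a)))
      (fun u h' => abs_mul_add_mul_le (hu u h') (hv u h') (by
        rw [neg_sq]; exact cos_sq_add_sin_sq _)) ha ht
    simp only [sub_self, cos_zero, sin_zero, mul_zero, sub_zero] at this
    rw [show x t - x a - (c a * sin (t - a) - d a * (1 - cos (t - a)))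
      = x t - (c a * sin (t - a) - d a * (1 - cos (t - a))) - x a by ring]
    nlinarith [h10 t ht]
  · have := abs_sub_le_of_hasDerivAt
      (f := fun u => y u - (c a * (1 - cos (u - a)) + d a * sin (u - a)))
      (f' := fun u => ((c u * cos (u - a) + d u * sin (u - a)) - c a) * sin (u - a)
        + ((c u * -sin (u - a) + d u * cos (u - a)) - d a) * cos (u - a)) (B := 2 * (10 * δ))
      (fun u hu => ((H.hy u hu).sub ((((hcos u).const_sub 1).const_mul (c a)).add
        ((hsin u).const_mul (d a)))).congr_deriv (by
          linear_combination (-d u) * sin_sq_add_cos_sq (u - a)))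
      (fun u h' => abs_mul_add_mul_le (hu u h') (hv u h') (sin_sq_add_cos_sq _)) ha ht
    simp only [sub_self, cos_zero, sin_zero, mul_zero, sub_zero, add_zero] at this
    rw [show y t - y a - (c a * (1 - cos (t - a)) + d a * sin (t - a))
      = y t - (c a * (1 - cos (t - a)) + d a * sin (t - a)) - y a by ring]
    nlinarith [h10 t ht]

/-- A pair of points at small positive distance `√m`, aligned with the normal, violates either
the inscribed or the outer radius bound. -/
lemma not_and_radii_bounds {m Q κ α δ ε : ℝ} (hα : 0 < α) (hα1 : α ≤ 1 / 1000) (hδ : 0 ≤ δ)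
    (hδα : 300 * δ ≤ α) (hε : 0 ≤ ε) (hε1 : ε ≤ 1) (hκ0 : 0 ≤ κ) (hκ : κ ≤ 2) (hm : 0 < m)
    (hmδ : m ≤ 80000 * δ ^ 2) (hQ : Q ^ 2 = m) (hin : 0 ≤ (1 + ε) * κ / 2 * m - Q)
    (hout : 0 ≤ κ / (2 * α) * m + Q) : False := by
  have hδ2 : (300 * δ) ^ 2 ≤ α ^ 2 := by gcongr
  have hα2 : α ^ 2 ≤ 1 / 1000000 := by nlinarith
  rcases lt_or_ge 0 Q with hQ0 | hQ0
  · have h1 : (1 + ε) * κ / 2 ≤ 2 := by nlinarith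
    have h2 : Q ≤ 2 * m := by nlinarith
    have h3 : 1 / 2 ≤ Q := by
      by_contra! hlt
      nlinarith
    nlinarith
  · have h1 : -Q * α ≤ m := by
      have e : κ / (2 * α) * m * α = κ / 2 * m := by field_simp
      nlinarith [mul_nonneg hout hα.le]
    have h2 : α ≤ -Q := by
      by_contra! hlt
      have : Q ≠ 0 := by rintro rfl; simp at hQ; linarith
      have : 0 < -Q := neg_pos.2 (lt_of_le_of_ne hQ0 this)
      nlinarith
    have h3 : α ^ 2 ≤ m := by rw [← hQ, ← neg_sq Q]; gcongr
    linarith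

/-- No embedded curve of length `3π` with curvature near `1` has outer radius at least `α / k`. -/
lemma FrenetOn.false_of_long {x y c d k : ℝ → ℝ} {a δ α ε : ℝ}
    (H : FrenetOn x y c d k (Icc a (a + 3 * π)))
    (hδ : ∀ u ∈ Icc a (a + 3 * π), |k u - 1| ≤ δ) (hα : 0 < α) (hα1 : α ≤ 1 / 1000)
    (hδα : 300 * δ ≤ α) (hε : 0 ≤ ε) (hε1 : ε ≤ 1)
    (hin : ∀ t ∈ Icc a (a + 3 * π), 0 ≤ (1 + ε) * k t / 2 *
      ((x t - x a) ^ 2 + (y t - y a) ^ 2) - ((x t - x a) * d t + (y t - y a) * -c t))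
    (hout : ∀ t ∈ Icc a (a + 3 * π), 0 ≤ k t / (2 * α) *
      ((x t - x a) ^ 2 + (y t - y a) ^ 2) + ((x t - x a) * d t + (y t - y a) * -c t))
    (hinj : ∀ t ∈ Icc a (a + 3 * π), x t = x a → y t = y a → t = a) : False := by
  have hπ := pi_pos
  have hcirc := fun t ht => H.abs_sub_circle_le (t := t) hδ ht
  have ha : a ∈ Icc a (a + 3 * π) := ⟨le_rfl, by linarith⟩
  have hδ0 : 0 ≤ δ := (abs_nonneg _).trans (hδ a ha)
  have hua := H.unit a ha
  set f : ℝ → ℝ := fun t => (x t - x a) ^ 2 + (y t - y a) ^ 2 with hf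
  have hsub : Icc (a + 3 * π / 2) (a + 5 * π / 2) ⊆ Icc a (a + 3 * π) :=
    Icc_subset_Icc (by linarith) (by linarith)
  have hfd : ∀ t ∈ Icc a (a + 3 * π),
      HasDerivAt f (2 * ((x t - x a) * c t + (y t - y a) * d t)) t := fun t ht =>
    ((((H.hx t ht).sub_const (x a)).pow 2).add
      (((H.hy t ht).sub_const (y a)).pow 2)).congr_deriv (by simp; ring)
  have sq_le : ∀ {e : ℝ}, |e| ≤ 200 * δ → e ^ 2 ≤ 40000 * δ ^ 2 := fun {e} he => by
    rw [← sq_abs]; nlinarith [abs_nonneg e]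
  have hδ2 : δ ^ 2 ≤ 1 / 90000000000 := by nlinarith
  have hmidmem : a + 2 * π ∈ Icc (a + 3 * π / 2) (a + 5 * π / 2) :=
    ⟨by linarith, by linarith⟩
  have hmid : f (a + 2 * π) ≤ 80000 * δ ^ 2 := by
    have := hcirc _ (hsub hmidmem)
    simp only [add_sub_cancel_left, sin_two_pi, cos_two_pi, mul_zero, sub_self, sub_zero,
      add_zero] at this
    linarith [sq_le this.1, sq_le this.2]
  have big : ∀ t ∈ Icc a (a + 3 * π), cos (t - a) = 0 → 80000 * δ ^ 2 < f t := by
    intro t ht hc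
    have hs := sin_sq_add_cos_sq (t - a)
    have h1 := hcirc t ht
    rw [hc] at h1 hs
    have e1 := sq_le h1.1
    have e2 := sq_le h1.2
    have e3 : (c a * sin (t - a) - d a * (1 - 0)) ^ 2 + (c a * (1 - 0) + d a * sin (t - a)) ^ 2
        = 2 := by linear_combination (c a ^ 2 + d a ^ 2) * hs + 2 * hua
    generalize c a * sin (t - a) - d a * (1 - 0) = P at *
    generalize c a * (1 - 0) + d a * sin (t - a) = Q at *
    simp only [hf]
    nlinarith [sq_nonneg (2 * (x t - x a) - P), sq_nonneg (2 * (y t - y a) - Q)]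
  obtain ⟨t, ht, hmin⟩ := isCompact_Icc.exists_isMinOn ⟨_, hmidmem⟩
    (fun u hu => (hfd u (hsub hu)).continuousAt.continuousWithinAt)
  have htm : f t ≤ 80000 * δ ^ 2 := (hmin hmidmem).trans hmid
  have hl : t ≠ a + 3 * π / 2 := by
    rintro rfl
    refine absurd (big _ (hsub ht) ?_) (not_lt.2 htm)
    rw [add_sub_cancel_left, show 3 * π / 2 = π / 2 + π by ring, cos_add_pi, cos_pi_div_two, neg_zero]
  have hr : t ≠ a + 5 * π / 2 := by
    rintro rfl
    refine absurd (big _ (hsub ht) ?_) (not_lt.2 htm)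
    rw [add_sub_cancel_left, show 5 * π / 2 = π / 2 + 2 * π by ring, cos_add_two_pi, cos_pi_div_two]
  have hcrit := (hmin.isLocalMin (Icc_mem_nhds (lt_of_le_of_ne ht.1 hl.symm)
    (lt_of_le_of_ne ht.2 hr))).hasDerivAt_eq_zero (hfd t (hsub ht))
  have ht' := hsub ht
  have hut := H.unit t ht'
  have i1 := hin t ht'
  have i2 := hout t ht'
  have hm : 0 < f t := by
    by_contra! h0
    have h1 : (x t - x a) ^ 2 + (y t - y a) ^ 2 ≤ 0 := h0
    have hx0 : x t - x a = 0 := pow_eq_zero_iff two_ne_zero |>.1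
      (le_antisymm (by linarith [sq_nonneg (y t - y a)]) (sq_nonneg _))
    have hy0 : y t - y a = 0 := pow_eq_zero_iff two_ne_zero |>.1
      (le_antisymm (by linarith [sq_nonneg (x t - x a)]) (sq_nonneg _))
    have := hinj t ht' (sub_eq_zero.1 hx0) (sub_eq_zero.1 hy0)
    linarith [ht.1]
  have hQ : ((x t - x a) * d t + (y t - y a) * -c t) ^ 2 = f t := by
    simp only [hf]
    linear_combination ((x t - x a) ^ 2 + (y t - y a) ^ 2) * hut
      - ((x t - x a) * c t + (y t - y a) * d t) / 2 * hcrit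
  have hkt := abs_le.1 (hδ t ht')
  have hδ1 : δ ≤ 1 / 2 := by linarith
  exact not_and_radii_bounds hα hα1 hδ0 hδα hε hε1 (by linarith) (by linarith) hm htm hQ i1 i2

lemma frenetOn_curve {γ : ℝ → ℝ × ℝ} {L : ℝ} (hL : 0 < L) (hsm : ContDiff ℝ 4 γ)
    (hunit : ∀ s ∈ Icc 0 L, nsq (deriv γ s) = 1) :
    FrenetOn (fun s => (γ s).1) (fun s => (γ s).2) (fun s => (deriv γ s).1)
      (fun s => (deriv γ s).2) (curv γ) (Icc 0 L) := by
  have hγ : ∀ s, HasDerivAt γ (deriv γ s) s := fun s =>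
    ((hsm.differentiable (by norm_num)) s).hasDerivAt
  have h1 : ContDiff ℝ 3 (deriv γ) := ContDiff.deriv' (n := 3) (hsm.of_le (by norm_num))
  have hc : ∀ s, HasDerivAt (fun s => (deriv γ s).1) (d2 γ s).1 s := fun s =>
    ((h1.fst.differentiable (by norm_num)) s).hasDerivAt
  have hd : ∀ s, HasDerivAt (fun s => (deriv γ s).2) (d2 γ s).2 s := fun s =>
    ((h1.snd.differentiable (by norm_num)) s).hasDerivAt
  have unit : ∀ s ∈ Icc 0 L, (deriv γ s).1 ^ 2 + (deriv γ s).2 ^ 2 = 1 := hunit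
  have orth : ∀ s ∈ Icc 0 L,
      (deriv γ s).1 * (d2 γ s).1 + (deriv γ s).2 * (d2 γ s).2 = 0 := fun s hs => by
    have e1 := (((hc s).pow 2).add ((hd s).pow 2)).hasDerivWithinAt (s := Icc 0 L)
    have e2 := (hasDerivWithinAt_const s (Icc 0 L) (1 : ℝ)).congr_of_mem
      (f₁ := fun s => (deriv γ s).1 ^ 2 + (deriv γ s).2 ^ 2) unit hs
    have := (uniqueDiffOn_Icc hL s hs).eq_deriv _ e1 e2
    simp at this
    linarith
  refine ⟨fun s _ => (hγ s).fst, fun s _ => (hγ s).snd, fun s hs => (hc s).congr_deriv ?_,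
    fun s hs => (hd s).congr_deriv ?_, unit⟩
  · unfold curv
    linear_combination (-(d2 γ s).1) * unit s hs + (deriv γ s).1 * orth s hs
  · unfold curv
    linear_combination (-(d2 γ s).2) * unit s hs + (deriv γ s).2 * orth s hs

lemma contDiff_curv {γ : ℝ → ℝ × ℝ} (hsm : ContDiff ℝ 4 γ) : ContDiff ℝ 2 (curv γ) := by
  have h1 : ContDiff ℝ 3 (deriv γ) := ContDiff.deriv' (n := 3) (hsm.of_le (by norm_num))
  have h2 : ContDiff ℝ 2 (deriv γ) := h1.of_le (by norm_num)
  exact (h2.fst.mul (ContDiff.deriv' (n := 2) (h1.snd.of_le (by norm_num)))).sub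
    (h2.snd.mul (ContDiff.deriv' (n := 2) (h1.fst.of_le (by norm_num))))

/-- The statement for a single curve, with explicit constants. -/
lemma length_lt_and_abs_curv_sub_one_le {γ : ℝ → ℝ × ℝ} {L C Θ α δ ε h p : ℝ} (hα : 0 < α)
    (hα1 : α ≤ 1 / 1000) (hC : 0 < C) (hΘ : 0 < Θ) (hL : 0 < L) (hinj : InjOn γ (Icc 0 L))
    (hsm : ContDiff ℝ 4 γ) (hunit : ∀ s ∈ Icc 0 L, nsq (deriv γ s) = 1)
    (hκpos : ∀ s ∈ Icc 0 L, 0 < curv γ s)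
    (hκ' : ∀ s ∈ Icc 0 L, |deriv (curv γ) s| ≤ C * (curv γ s + 2 * Θ) ^ 2)
    (hκ'' : ∀ s ∈ Icc 0 L, |deriv (deriv (curv γ)) s| ≤ C * (curv γ s + 2 * Θ) ^ 3)
    (hin : ∀ s ∈ Icc 0 L, ∀ t ∈ Icc 0 L,
      (1 + ε) * curv γ s / 2 * nsq (γ s - γ t) - dot (γ s - γ t) (nor γ s) ≥ 0)
    (hout : ∀ s ∈ Icc 0 L, ∀ t ∈ Icc 0 L,
      curv γ s / (2 * α) * nsq (γ s - γ t) + dot (γ s - γ t) (nor γ s) ≥ 0)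
    (hp : p ∈ Icc 0 L) (hκp : curv γ p = 1) (hh : 0 < h) (hε : 0 ≤ ε) (hε1 : ε ≤ 1)
    (hδ : δ ≤ 1 / 2) (hδα : 300 * δ ≤ α)
    (hD : curvDefect (C * (2 + 2 * Θ) ^ 2) (C * (2 + 2 * Θ) ^ 3) ε h ≤ δ) :
    L < 3 * π ∧ ∀ s ∈ Icc 0 L, |curv γ s - 1| ≤ δ := by
  have H := frenetOn_curve hL hsm hunit
  have hcd := contDiff_curv hsm
  have hk : ∀ s, HasDerivAt (curv γ) (deriv (curv γ) s) s := fun s =>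
    ((hcd.differentiable (by norm_num)) s).hasDerivAt
  have hk1 : ∀ s, HasDerivAt (deriv (curv γ)) (deriv (deriv (curv γ)) s) s := fun s =>
    (((ContDiff.deriv' (n := 1) (hcd.of_le (by norm_num))).differentiable (by norm_num)) s).hasDerivAt
  have key : ∀ a b, Icc a b ⊆ Icc 0 L → b - a ≤ 3 * π → p ∈ Icc a b → ∀ s ∈ Icc a b,
      |curv γ s - 1| ≤ δ := fun a b hsub hab hpab s hs =>
    ((H.mono hsub).abs_sub_one_le (fun u _ => hk u) (fun u _ => hk1 u) hC.le hΘ.le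
      (fun u hu => hκpos u (hsub hu)) (fun u hu => hκ' u (hsub hu))
      (fun u hu => hκ'' u (hsub hu)) hh hε (fun s hs t ht => by
        have := hin s (hsub hs) t (hsub ht)
        simp only [nsq, dot, nor, Prod.fst_sub, Prod.snd_sub] at this
        linarith) hab hpab hκp (hD.trans hδ) hs).trans hD
  have hlt : L < 3 * π := by
    by_contra! hge
    have hsub : Icc (max 0 (p - 3 * π)) (max 0 (p - 3 * π) + 3 * π) ⊆ Icc 0 L := by
      refine Icc_subset_Icc (le_max_left _ _) ?_
      rcases max_cases 0 (p - 3 * π) with h' | h' <;> linarith [hp.2]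
    have hpm : p ∈ Icc (max 0 (p - 3 * π)) (max 0 (p - 3 * π) + 3 * π) :=
      ⟨max_le hp.1 (by linarith [pi_pos]), by linarith [le_max_right 0 (p - 3 * π)]⟩
    generalize max 0 (p - 3 * π) = a at *
    have ha : a ∈ Icc 0 L := hsub (left_mem_Icc.2 (by linarith [pi_pos]))
    exact (H.mono hsub).false_of_long (key a _ hsub (by linarith) hpm) hα hα1 hδα hε hε1
      (fun t ht => hin t (hsub ht) a ha) (fun t ht => hout t (hsub ht) a ha)
      (fun t ht h1 h2 => hinj (hsub ht) ha (Prod.ext h1 h2))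
  exact ⟨hlt, key 0 L Subset.rfl (by linarith) hp⟩

/-- The defect can be made small by choosing `h` small, then `ε` small. -/
lemma exists_curvDefect_le {K1 K2 δ : ℝ} (hK1 : 0 ≤ K1) (hK2 : 0 ≤ K2) (hδ : 0 < δ) :
    ∃ h > 0, ∃ ε₀ > 0, ∀ ε ≤ ε₀, curvDefect K1 K2 ε h ≤ δ := by
  set N := 10 * ((6 * K1 + K2 + 24) / 4 + K2) + 2 * K1 with hN
  have hN0 : 0 < N := by positivity
  refine ⟨δ / (2 * N), by positivity, δ / 240 * (δ / (2 * N)), by positivity, fun ε hε => ?_⟩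
  have hh : 0 < δ / (2 * N) := by positivity
  have e1 : N * (δ / (2 * N)) = δ / 2 := by field_simp
  generalize δ / (2 * N) = h at *
  have e2 : ε / h ≤ δ / 240 := (div_le_iff₀ hh).2 hε
  have e3 : curvDefect K1 K2 ε h = 120 * (ε / h) + N * h := by
    unfold curvDefect; rw [hN]; ring
  linarith

/-- For a sequence of injective unit-speed `C⁴` curves `γ_j` on
`[0, L_j]` (`L_j > 0`) with positive curvature satisfying the derivative bounds
`|κ'| ≤ C#(κ + 2Θ)²` and `|κ''| ≤ C#(κ + 2Θ)³`, inscribed radius at least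
`1/((1+1/j)κ)` and outer radius at least `α/κ` everywhere, and `κ_j(p_j) = 1` for
some `p_j`, eventually `L_j < 3π`, and `sup |κ_j − 1| → 0`. -/
theorem stmt4 (α Csharp Θ : ℝ) (hα : α ∈ Set.Ioc (0 : ℝ) (1 / 1000))
    (hC : 0 < Csharp) (hΘ : 0 < Θ)
    (L : ℕ → ℝ) (γ : ℕ → ℝ → ℝ × ℝ) (p : ℕ → ℝ)
    (hL : ∀ j : ℕ, 1 ≤ j → 0 < L j)
    (hinj : ∀ j : ℕ, 1 ≤ j → Set.InjOn (γ j) (Icc 0 (L j)))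
    (hsm : ∀ j : ℕ, 1 ≤ j → ContDiff ℝ 4 (γ j))
    (hunit : ∀ j : ℕ, 1 ≤ j → ∀ s ∈ Icc 0 (L j), nsq (deriv (γ j) s) = 1)
    (hκpos : ∀ j : ℕ, 1 ≤ j → ∀ s ∈ Icc 0 (L j), 0 < curv (γ j) s)
    (hκ' : ∀ j : ℕ, 1 ≤ j → ∀ s ∈ Icc 0 (L j),
      |deriv (curv (γ j)) s| ≤ Csharp * (curv (γ j) s + 2 * Θ) ^ 2)
    (hκ'' : ∀ j : ℕ, 1 ≤ j → ∀ s ∈ Icc 0 (L j),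
      |deriv (deriv (curv (γ j))) s| ≤ Csharp * (curv (γ j) s + 2 * Θ) ^ 3)
    (hin : ∀ j : ℕ, 1 ≤ j → ∀ s ∈ Icc 0 (L j), ∀ t ∈ Icc 0 (L j),
      (1 + 1 / (j : ℝ)) * curv (γ j) s / 2 * nsq (γ j s - γ j t)
        - dot (γ j s - γ j t) (nor (γ j) s) ≥ 0)
    (hout : ∀ j : ℕ, 1 ≤ j → ∀ s ∈ Icc 0 (L j), ∀ t ∈ Icc 0 (L j),
      curv (γ j) s / (2 * α) * nsq (γ j s - γ j t)
        + dot (γ j s - γ j t) (nor (γ j) s) ≥ 0)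
    (hp : ∀ j : ℕ, 1 ≤ j → p j ∈ Icc 0 (L j) ∧ curv (γ j) (p j) = 1) :
    (∃ J : ℕ, ∀ j : ℕ, J ≤ j → L j < 3 * π) ∧
    Tendsto (fun j : ℕ => sSup ((fun s => |curv (γ j) s - 1|) '' Icc 0 (L j)))
      atTop (nhds 0) := by
  have main : ∀ η > 0, ∃ J : ℕ, ∀ j ≥ J, 1 ≤ j ∧ L j < 3 * π ∧
      ∀ s ∈ Icc 0 (L j), |curv (γ j) s - 1| ≤ η := by
    intro η hη
    have hα0 := hα.1
    obtain ⟨h, hh, ε₀, hε₀, hdef⟩ := exists_curvDefect_le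
      (K1 := Csharp * (2 + 2 * Θ) ^ 2) (K2 := Csharp * (2 + 2 * Θ) ^ 3)
      (δ := min η (α / 300)) (by positivity) (by positivity) (by positivity)
    obtain ⟨J, hJ⟩ := exists_nat_one_div_lt hε₀
    refine ⟨J + 1, fun j hj => ?_⟩
    have hj1 : 1 ≤ j := by omega
    have hjc : (1 : ℝ) ≤ j := by exact_mod_cast hj1
    have hjJ : (J : ℝ) + 1 ≤ j := by exact_mod_cast hj
    have hε : 1 / (j : ℝ) ≤ ε₀ := (one_div_le_one_div_of_le (by positivity) hjJ).trans hJ.le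
    have hmin := min_le_right η (α / 300)
    have := length_lt_and_abs_curv_sub_one_le (ε := 1 / (j : ℝ)) hα0 hα.2 hC hΘ (hL j hj1)
      (hinj j hj1) (hsm j hj1) (hunit j hj1) (hκpos j hj1) (hκ' j hj1) (hκ'' j hj1) (hin j hj1)
      (hout j hj1) (hp j hj1).1 (hp j hj1).2 hh (by positivity)
      ((div_le_one (by positivity)).2 hjc) (by linarith [hα.2]) (by linarith) (hdef _ hε)
    exact ⟨hj1, this.1, fun s hs => (this.2 s hs).trans (min_le_left _ _)⟩
  constructor
  · obtain ⟨J, hJ⟩ := main 1 one_pos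
    exact ⟨J, fun j hj => (hJ j hj).2.1⟩
  · rw [Metric.tendsto_atTop]
    intro η hη
    obtain ⟨J, hJ⟩ := main (η / 2) (half_pos hη)
    refine ⟨J, fun j hj => ?_⟩
    obtain ⟨hj1, -, hb⟩ := hJ j hj
    have hle : sSup ((fun s => |curv (γ j) s - 1|) '' Icc 0 (L j)) ≤ η / 2 :=
      csSup_le ((nonempty_Icc.2 (hL j hj1).le).image _) (by rintro _ ⟨s, hs, rfl⟩; exact hb s hs)
    have hnn : 0 ≤ sSup ((fun s => |curv (γ j) s - 1|) '' Icc 0 (L j)) :=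
      Real.sSup_nonneg (by rintro _ ⟨s, _, rfl⟩; exact abs_nonneg _)
    rw [Real.dist_eq, sub_zero, abs_of_nonneg hnn]
    linarith

end
end
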